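/- Let p ∈ [1,∞], let d ≥ 1, let q ≥ 1 be an integer, let G > 0, β > 0, and let f : ℝ^d → ℝ be G-Lipschitz with respect to ‖·‖_p. Then the iterated smoothing S^{(q)}_β[f] is q-times differentiable, and for every i ∈ {0,1,…,q} and all vectors v₁,…,v_i ∈ ℝ^d with ‖v_j‖_p ≤ 1, the map x ↦ ∇^i S^{(q)}_β[f](x)[v₁,…,v_i] is Lipschitz with respect to ‖·‖_p with constant d^i·2^{i(i+1)/2}·G/β^i. -/

import Mathlib

open MeasureTheory ENNReal

/-- The ℓ_p norm on `ℝ^d` for `p ∈ [1,∞]`. -/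
noncomputable def pNorm {d : ℕ} (p : ℝ≥0∞) (x : Fin d → ℝ) : ℝ :=
  if p = ∞ then ⨆ i, |x i| else (∑ i, |x i| ^ p.toReal) ^ (1 / p.toReal)

/-- Randomized smoothing: `S_β[f](x) = E_{v ∼ ν(B^p_β)}[f(x+v)]`. -/
noncomputable def smoothing {d : ℕ} (p : ℝ≥0∞) (β : ℝ)
    (f : (Fin d → ℝ) → ℝ) (x : Fin d → ℝ) : ℝ :=
  ⨍ v in {v : Fin d → ℝ | pNorm p v ≤ β}, f (x + v)

/-- Iterated smoothing: `S^{(q)}_β[f] = (S_{β/2^q} ∘ S_{β/2^{q−1}} ∘ ⋯ ∘ S_{β/2})[f]`. -/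
noncomputable def iterSmooth {d : ℕ} (p : ℝ≥0∞) (β : ℝ) :
    ℕ → ((Fin d → ℝ) → ℝ) → ((Fin d → ℝ) → ℝ)
  | 0, f => f
  | (q + 1), f => smoothing p (β / 2 ^ (q + 1)) (iterSmooth p β q f)

theorem pNorm_eq {d : ℕ} (p : ℝ≥0∞) [hp : Fact (1 ≤ p)] (x : Fin d → ℝ) :
    pNorm p x = ‖(PiLp.continuousLinearEquiv p ℝ (fun _ : Fin d => ℝ)).symm x‖ := by
  unfold pNorm
  split_ifs with h
  · subst h
    rw [PiLp.norm_eq_ciSup]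
    rfl
  · have h0 : 0 < p.toReal :=
      ENNReal.toReal_pos (zero_lt_one.trans_le hp.out).ne' h
    rw [PiLp.norm_eq_sum h0]
    rfl

section
variable {d : ℕ} {p : ℝ≥0∞} [hp : Fact (1 ≤ p)]

theorem pNorm_nonneg (x : Fin d → ℝ) : 0 ≤ pNorm p x := by
  rw [pNorm_eq]; positivity

theorem pNorm_add_le (x y : Fin d → ℝ) : pNorm p (x + y) ≤ pNorm p x + pNorm p y := by
  simp only [pNorm_eq, map_add]; exact norm_add_le _ _

theorem pNorm_smul (c : ℝ) (x : Fin d → ℝ) : pNorm p (c • x) = |c| * pNorm p x := by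
  simp only [pNorm_eq, map_smul, norm_smul, Real.norm_eq_abs]

theorem pNorm_neg (x : Fin d → ℝ) : pNorm p (-x) = pNorm p x := by
  simp only [pNorm_eq, map_neg, norm_neg]

theorem pNorm_zero : pNorm p (0 : Fin d → ℝ) = 0 := by
  simp only [pNorm_eq, map_zero, norm_zero]

theorem pNorm_continuous : Continuous (pNorm p : (Fin d → ℝ) → ℝ) := by
  have : (pNorm p : (Fin d → ℝ) → ℝ) = fun x => ‖(PiLp.continuousLinearEquiv p ℝ (fun _ : Fin d => ℝ)).symm x‖ := 
    funext fun x => pNorm_eq p x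
  rw [this]
  fun_prop

theorem pNorm_le_const : ∃ C : ℝ, 0 ≤ C ∧ ∀ x : Fin d → ℝ, pNorm p x ≤ C * ‖x‖ := by
  refine ⟨‖((PiLp.continuousLinearEquiv p ℝ (fun _ : Fin d => ℝ)).symm : (Fin d → ℝ) →L[ℝ] PiLp p (fun _ : Fin d => ℝ))‖,
    norm_nonneg _, fun x => ?_⟩
  rw [pNorm_eq]
  exact ContinuousLinearMap.le_opNorm
    ((PiLp.continuousLinearEquiv p ℝ (fun _ : Fin d => ℝ)).symm : (Fin d → ℝ) →L[ℝ] PiLp p (fun _ : Fin d => ℝ)) x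

theorem norm_le_pNorm : ∃ C : ℝ, 0 ≤ C ∧ ∀ x : Fin d → ℝ, ‖x‖ ≤ C * pNorm p x := by
  refine ⟨‖((PiLp.continuousLinearEquiv p ℝ (fun _ : Fin d => ℝ)) : PiLp p (fun _ : Fin d => ℝ) →L[ℝ] (Fin d → ℝ))‖,
    norm_nonneg _, fun x => ?_⟩
  rw [pNorm_eq]
  have := ContinuousLinearMap.le_opNorm
    ((PiLp.continuousLinearEquiv p ℝ (fun _ : Fin d => ℝ)) : PiLp p (fun _ : Fin d => ℝ) →L[ℝ] (Fin d → ℝ))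
    ((PiLp.continuousLinearEquiv p ℝ (fun _ : Fin d => ℝ)).symm x)
  exact this

variable (p) in
/-- The closed ball. -/
def pBall (r : ℝ) : Set (Fin d → ℝ) := {v | pNorm p v ≤ r}

theorem pBall_closed (r : ℝ) : IsClosed (pBall p r : Set (Fin d → ℝ)) :=
  isClosed_le pNorm_continuous continuous_const

theorem pBall_meas (r : ℝ) : MeasurableSet (pBall p r : Set (Fin d → ℝ)) :=
  (pBall_closed r).measurableSet

theorem pBall_compact (r : ℝ) : IsCompact (pBall p r : Set (Fin d → ℝ)) := by
  obtain ⟨C, hC, h⟩ := norm_le_pNorm (d := d) (p := p)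
  refine (isCompact_closedBall (0 : Fin d → ℝ) (C * r)).of_isClosed_subset (pBall_closed r) ?_
  intro x hx
  rw [mem_closedBall_zero_iff]
  exact (h x).trans (mul_le_mul_of_nonneg_left hx hC)

theorem pBall_fin (r : ℝ) : volume (pBall p r : Set (Fin d → ℝ)) ≠ ∞ :=
  (pBall_compact r).measure_lt_top.ne

theorem pBall_pos {r : ℝ} (hr : 0 < r) : volume (pBall p r : Set (Fin d → ℝ)) ≠ 0 := by
  have ho : IsOpen {x : Fin d → ℝ | pNorm p x < r} := isOpen_lt pNorm_continuous continuous_const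
  have := ho.measure_pos (volume : Measure (Fin d → ℝ)) ⟨0, by simp [pNorm_zero, hr]⟩
  exact (this.trans_le (measure_mono fun x (hx : pNorm p x < r) => (le_of_lt hx : pNorm p x ≤ r))).ne'

open scoped Pointwise in
theorem pBall_scale {c : ℝ} (hc : 0 ≤ c) {r : ℝ} :
    c ^ d * volume.real (pBall p r : Set (Fin d → ℝ)) ≤
      volume.real (pBall p (c * r) : Set (Fin d → ℝ)) := by
  have h1 : volume.real (c • (pBall p r : Set (Fin d → ℝ))) =
      c ^ d * volume.real (pBall p r : Set (Fin d → ℝ)) := by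
    rw [measureReal_def, Measure.addHaar_smul, ENNReal.toReal_mul, measureReal_def]
    simp
    exact Or.inl (by rw [abs_of_nonneg hc])
  rw [← h1]
  refine measureReal_mono ?_ (pBall_fin _)
  rintro _ ⟨x, hx, rfl⟩
  simp only [pBall, Set.mem_ofPred_eq, pNorm_smul, abs_of_nonneg hc] at hx ⊢
  exact mul_le_mul_of_nonneg_left hx hc

/-- Overlap of two shifted balls. -/
theorem overlap (hd : 1 ≤ d) {r : ℝ} (hr : 0 < r) (u : Fin d → ℝ) :
    (1 - d * pNorm p u / (2 * r)) * volume.real (pBall p r : Set (Fin d → ℝ)) ≤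
      volume.real ((pBall p r : Set (Fin d → ℝ)) ∩ {x | x - u ∈ (pBall p r : Set (Fin d → ℝ))}) := by
  have hN := pNorm_nonneg (p := p) u
  have hd' : (1 : ℝ) ≤ d := by exact_mod_cast hd
  have hfin : volume ((pBall p r : Set (Fin d → ℝ)) ∩ {x | x - u ∈ (pBall p r : Set (Fin d → ℝ))}) ≠ ∞ :=
    measure_ne_top_of_subset Set.inter_subset_left (pBall_fin (p := p) r)
  by_cases hu : pNorm p u ≤ 2 * r
  · set a := pNorm p u / (2 * r) with ha
    have ha1 : a ≤ 1 := by rw [ha, div_le_one (by positivity)]; exact hu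
    have ha0 : 0 ≤ a := by positivity
    have har : (1 - a) * r = r - pNorm p u / 2 := by rw [ha]; field_simp
    have hb : 1 - d * pNorm p u / (2 * r) ≤ (1 - a) ^ d := by
      have := one_add_mul_le_pow (a := -a) (by linarith) d
      have e : 1 - d * pNorm p u / (2 * r) = 1 + d * (-a) := by rw [ha]; ring
      rw [e]; simpa [sub_eq_add_neg] using this
    refine (mul_le_mul_of_nonneg_right hb measureReal_nonneg).trans
      ((pBall_scale (p := p) (by linarith : 0 ≤ 1 - a)).trans ?_)
    have ht : volume.real (pBall p ((1 - a) * r) : Set (Fin d → ℝ)) =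
        volume.real ((fun x => x + -((1 / 2 : ℝ) • u)) ⁻¹' (pBall p ((1 - a) * r) : Set (Fin d → ℝ))) := by
      rw [measureReal_def, measureReal_def, measure_preimage_add_right]
    rw [ht]
    refine measureReal_mono ?_ hfin
    intro x hx
    simp only [pBall, Set.mem_ofPred_eq, Set.mem_preimage, Set.mem_inter_iff, har] at hx ⊢
    have h2 : pNorm p ((1 / 2 : ℝ) • u) = pNorm p u / 2 := by
      rw [pNorm_smul, abs_of_pos (by norm_num)]; ring
    constructor
    · have := pNorm_add_le (p := p) (x + -((1 / 2 : ℝ) • u)) ((1 / 2 : ℝ) • u)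
      rw [h2, neg_add_cancel_right] at this
      linarith
    · have := pNorm_add_le (p := p) (x + -((1 / 2 : ℝ) • u)) (-((1 / 2 : ℝ) • u))
      rw [pNorm_neg, h2] at this
      have e : x + -((1 / 2 : ℝ) • u) + -((1 / 2 : ℝ) • u) = x - u := by
        ext i; simp; ring
      rw [e] at this
      linarith
  · push Not at hu
    refine le_trans ?_ measureReal_nonneg
    refine mul_nonpos_of_nonpos_of_nonneg ?_ measureReal_nonneg
    rw [sub_nonpos, le_div_iff₀ (by positivity)]
    nlinarith

theorem smoothing_bdd_diff (hd : 1 ≤ d) {r : ℝ} (hr : 0 < r) (φ : (Fin d → ℝ) → ℝ)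
    (hc : Continuous φ) {M : ℝ} (hM : ∀ x, |φ x| ≤ M) (x u : Fin d → ℝ) :
    |smoothing p r φ (x + u) - smoothing p r φ x| ≤ M * (d / r) * pNorm p u := by
  set B : Set (Fin d → ℝ) := pBall p r with hB
  set B' : Set (Fin d → ℝ) := {x | x - u ∈ B} with hB'
  have hBm : MeasurableSet B := pBall_meas r
  have hpre : B' = (fun x => x + -u) ⁻¹' B := by
    ext x; simp [hB', sub_eq_add_neg]
  have hB'm : MeasurableSet B' := by
    rw [hpre]; exact (measurable_id.add_const _) hBm
  have hvol : volume B' = volume B := by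
    rw [hpre, measure_preimage_add_right]
  have hBf : volume B ≠ ∞ := pBall_fin r
  have hB'f : volume B' ≠ ∞ := hvol ▸ hBf
  have hM0 : 0 ≤ M := (abs_nonneg _).trans (hM 0)
  have hV : 0 < volume.real B := ENNReal.toReal_pos (pBall_pos hr) hBf
  have hint : ∀ s : Set (Fin d → ℝ), volume s ≠ ∞ → IntegrableOn (fun v => φ (x + v)) s := by
    intro s hs
    refine Measure.integrableOn_of_bounded (M := M) hs (by fun_prop) ?_
    exact Filter.Eventually.of_forall fun v => hM _
  have hshift : ∫ v in B, φ (x + u + v) = ∫ v in B', φ (x + v) := by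
    have hmp := (measurePreserving_add_right (volume : Measure (Fin d → ℝ)) (-u))
    have hme : MeasurableEmbedding (fun x : Fin d → ℝ => x + -u) :=
      measurableEmbedding_addRight (-u)
    rw [hpre, ← hmp.setIntegral_preimage_emb hme]
    congr 1
    ext v
    congr 1
    ext i
    simp only [Pi.add_apply, Pi.neg_apply]
    ring
  have e1 : ∫ v in B', φ (x + v) = (∫ v in B ∩ B', φ (x + v)) + ∫ v in B' \ B, φ (x + v) := by
    rw [Set.inter_comm, integral_inter_add_sdiff hBm (hint _ hB'f)]
  have e2 : ∫ v in B, φ (x + v) = (∫ v in B ∩ B', φ (x + v)) + ∫ v in B \ B', φ (x + v) := by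
    rw [integral_inter_add_sdiff hB'm (hint _ hBf)]
  have hb1 : |∫ v in B' \ B, φ (x + v)| ≤ M * volume.real (B' \ B) :=
    norm_setIntegral_le_of_norm_le_const (f := fun v => φ (x + v)) (C := M)
      (measure_ne_top_of_subset Set.sdiff_subset hB'f).lt_top (fun v _ => hM _)
  have hb2 : |∫ v in B \ B', φ (x + v)| ≤ M * volume.real (B \ B') :=
    norm_setIntegral_le_of_norm_le_const (f := fun v => φ (x + v)) (C := M)
      (measure_ne_top_of_subset Set.sdiff_subset hBf).lt_top (fun v _ => hM _)
  have hv1 : volume.real (B ∩ B') + volume.real (B \ B') = volume.real B :=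
    measureReal_inter_add_diff hB'm hBf
  have hv2 : volume.real (B ∩ B') + volume.real (B' \ B) = volume.real B := by
    rw [Set.inter_comm, measureReal_inter_add_diff hBm hB'f, measureReal_def, hvol, measureReal_def]
  have hov := overlap (p := p) hd hr u
  rw [← hB, ← hB'] at hov
  have hS : ∀ y, smoothing p r φ y = (volume.real B)⁻¹ * ∫ v in B, φ (y + v) := by
    intro y
    unfold smoothing
    rw [setAverage_eq, smul_eq_mul]
    rfl
  rw [hS, hS, ← mul_sub, abs_mul, abs_of_pos (inv_pos.2 hV), inv_mul_le_iff₀ hV, hshift, e1, e2]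
  have : |(∫ v in B ∩ B', φ (x + v)) + (∫ v in B' \ B, φ (x + v)) -
      ((∫ v in B ∩ B', φ (x + v)) + ∫ v in B \ B', φ (x + v))| ≤
      M * (2 * (volume.real B - volume.real (B ∩ B'))) := by
    rw [add_sub_add_left_eq_sub]
    refine (abs_sub _ _).trans ?_
    have : M * (2 * (volume.real B - volume.real (B ∩ B'))) =
      M * volume.real (B' \ B) + M * volume.real (B \ B') := by
      rw [← mul_add]; congr 1; linarith
    linarith
  refine this.trans ?_
  have e3 : volume.real B * (M * (d / r) * pNorm p u) =
      M * (2 * (d * pNorm p u / (2 * r) * volume.real B)) := by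
    field_simp
  rw [e3]
  refine mul_le_mul_of_nonneg_left ?_ hM0
  linarith

/-- Lipschitz wrt the ℓ_p norm. -/
def PLip (p : ℝ≥0∞) (K : ℝ) (h : (Fin d → ℝ) → ℝ) : Prop :=
  ∀ x y, |h x - h y| ≤ K * pNorm p (x - y)

theorem PLip.lip {K : ℝ} {h : (Fin d → ℝ) → ℝ} (hK : 0 ≤ K) (hh : PLip p K h) :
    ∃ C, LipschitzWith C h := by
  obtain ⟨C, hC, hN⟩ := pNorm_le_const (d := d) (p := p)
  refine ⟨(K * C).toNNReal, LipschitzWith.of_dist_le_mul fun x y => ?_⟩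
  rw [Real.dist_eq, dist_eq_norm, Real.coe_toNNReal _ (by positivity), mul_assoc]
  exact (hh x y).trans (mul_le_mul_of_nonneg_left (hN _) hK)

/-- The uniform measure. -/
noncomputable def uni (p : ℝ≥0∞) (r : ℝ) : Measure (Fin d → ℝ) :=
  ((volume : Measure (Fin d → ℝ)).restrict (pBall p r) Set.univ)⁻¹ •
    (volume : Measure (Fin d → ℝ)).restrict (pBall p r)

theorem smoothing_eq (r : ℝ) (h : (Fin d → ℝ) → ℝ) (x : Fin d → ℝ) :
    smoothing p r h x = ∫ v, h (x + v) ∂(uni p r) := rfl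

theorem uni_prob {r : ℝ} (hr : 0 < r) : IsProbabilityMeasure (uni p r : Measure (Fin d → ℝ)) := by
  constructor
  simp only [uni, Measure.smul_apply, Measure.restrict_apply_univ, smul_eq_mul]
  exact ENNReal.inv_mul_cancel (pBall_pos hr) (pBall_fin r)

theorem uni_ac (r : ℝ) : (uni p r : Measure (Fin d → ℝ)) ≪ volume :=
  (Measure.smul_absolutelyContinuous).trans Measure.absolutelyContinuous_restrict

theorem uni_int {r : ℝ} (hr : 0 < r) {h : (Fin d → ℝ) → ℝ} (hh : Continuous h) (x : Fin d → ℝ) :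
    Integrable (fun v => h (x + v)) (uni p r) := by
  unfold uni
  refine Integrable.smul_measure ?_ ?_
  · exact (by fun_prop : Continuous fun v => h (x + v)).continuousOn.integrableOn_compact
      (pBall_compact r)
  · rw [Measure.restrict_apply_univ]
    exact ENNReal.inv_ne_top.2 (pBall_pos hr)

theorem smoothing_lip {r : ℝ} (hr : 0 < r) {K : ℝ} (hK : 0 ≤ K) {h : (Fin d → ℝ) → ℝ}
    (hh : PLip p K h) : PLip p K (smoothing p r h) := by
  intro x y
  have := uni_prob (d := d) (p := p) hr
  obtain ⟨C, hC⟩ := hh.lip hK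
  rw [smoothing_eq, smoothing_eq, ← integral_sub (uni_int hr hC.continuous _)
    (uni_int hr hC.continuous _)]
  have := norm_integral_le_of_norm_le_const (μ := (uni p r : Measure (Fin d → ℝ)))
    (f := fun v => h (x + v) - h (y + v)) (C := K * pNorm p (x - y))
    (Filter.Eventually.of_forall fun v => by
      have := hh (x + v) (y + v)
      rwa [add_sub_add_right_eq_sub] at this)
  simpa using this

theorem smoothing_hasFDerivAt {r : ℝ} (hr : 0 < r) {K : ℝ} (hK : 0 ≤ K) {h : (Fin d → ℝ) → ℝ}
    (hh : PLip p K h) (x : Fin d → ℝ) :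
    Integrable (fun v => fderiv ℝ h (x + v)) (uni p r) ∧
    HasFDerivAt (smoothing p r h) (∫ v, fderiv ℝ h (x + v) ∂(uni p r)) x := by
  have := uni_prob (d := d) (p := p) hr
  obtain ⟨C, hC⟩ := hh.lip hK
  refine hasFDerivAt_integral_of_dominated_loc_of_lip (F := fun x v => h (x + v))
    (bound := fun _ => (C : ℝ)) (s := Set.univ) Filter.univ_mem ?_ (uni_int hr hC.continuous _) ?_ ?_
    (integrable_const _) ?_
  · exact Filter.Eventually.of_forall fun x => (uni_int hr hC.continuous x).aestronglyMeasurable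
  · exact ((measurable_fderiv ℝ h).comp (measurable_const_add x)).aestronglyMeasurable
  · refine Filter.Eventually.of_forall fun v => ?_
    have e : Real.nnabs (C : ℝ) = C := by simp
    rw [e, lipschitzOnWith_univ]
    refine LipschitzWith.of_dist_le_mul fun a b => ?_
    simpa using hC.dist_le_mul (a + v) (b + v)
  · refine (uni_ac r).ae_le ?_
    have h1 : ∀ᵐ v : Fin d → ℝ, DifferentiableAt ℝ h v := hC.ae_differentiableAt
    have h2 := (measurePreserving_add_left (volume : Measure (Fin d → ℝ)) x).quasiMeasurePreserving.ae h1
    filter_upwards [h2] with v hv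
    exact (hasFDerivAt_comp_add_right v).2 hv.hasFDerivAt

theorem smoothing_fderiv_lip (hd : 1 ≤ d) {r : ℝ} (hr : 0 < r) {K : ℝ} (hK : 0 ≤ K)
    {h : (Fin d → ℝ) → ℝ} (hh : PLip p K h) (v : Fin d → ℝ) :
    PLip p (d / r * K * pNorm p v) (fun x => fderiv ℝ (smoothing p r h) x v) := by
  intro x y
  obtain ⟨C, hC⟩ := hh.lip hK
  have hdiff : Differentiable ℝ (smoothing p r h) := fun x =>
    (smoothing_hasFDerivAt hr hK hh x).2.differentiableAt
  have hcont := hC.continuous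
  set φ : (Fin d → ℝ) → ℝ := fun z => h (x + z) - h (y + z) with hφ
  have hφc : Continuous φ := by fun_prop
  have hφM : ∀ z, |φ z| ≤ K * pNorm p (x - y) := fun z => by
    have := hh (x + z) (y + z)
    rwa [add_sub_add_right_eq_sub] at this
  have hS : ∀ z, smoothing p r φ z = smoothing p r h (x + z) - smoothing p r h (y + z) := by
    intro z
    simp only [smoothing_eq, hφ]
    rw [← integral_sub (uni_int hr hcont _) (uni_int hr hcont _)]
    simp only [add_assoc]
  have hder : HasDerivAt (fun t : ℝ => smoothing p r h (x + t • v) - smoothing p r h (y + t • v))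
      (fderiv ℝ (smoothing p r h) x v - fderiv ℝ (smoothing p r h) y v) 0 := by
    have key : ∀ a : Fin d → ℝ, HasDerivAt (fun t : ℝ => smoothing p r h (a + t • v))
        (fderiv ℝ (smoothing p r h) a v) 0 := fun a =>
      (hdiff a).hasFDerivAt.hasLineDerivAt v
    exact (key x).sub (key y)
  have hN := pNorm_nonneg (p := p) v
  have hN' := pNorm_nonneg (p := p) (x - y)
  have := hder.le_of_lip' (C := d / r * K * pNorm p v * pNorm p (x - y)) (by positivity)
    (Filter.Eventually.of_forall fun t => by
      rw [← hS, ← hS]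
      have := smoothing_bdd_diff (p := p) hd hr φ hφc hφM 0 (t • v)
      rw [zero_add, pNorm_smul] at this
      simp only [zero_smul, sub_zero, Real.norm_eq_abs]
      refine this.trans (le_of_eq ?_)
      ring)
  exact this

/-- Iterated Lipschitz regularity up to order `n` with constants `c`. -/
def Good (p : ℝ≥0∞) : ℕ → (ℕ → ℝ) → ((Fin d → ℝ) → ℝ) → Prop
  | 0, c, h => PLip p (c 0) h
  | n + 1, c, h => PLip p (c 0) h ∧ Differentiable ℝ h ∧
      ∀ v, Good p n (fun i => c (i + 1) * pNorm p v) (fun x => fderiv ℝ h x v)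

theorem Good.zero {n : ℕ} {c : ℕ → ℝ} {h : (Fin d → ℝ) → ℝ} (H : Good p n c h) :
    PLip p (c 0) h := by
  cases n with
  | zero => exact H
  | succ n => exact H.1

theorem Good.smoothing (hd : 1 ≤ d) {r : ℝ} (hr : 0 < r) (n : ℕ) :
    ∀ (c : ℕ → ℝ) (h : (Fin d → ℝ) → ℝ), (∀ i, 0 ≤ c i) → c (n + 1) = d / r * c n →
      Good p n c h → Good p (n + 1) c (smoothing p r h) := by
  induction n with
  | zero =>
    intro c h hc hcn H
    refine ⟨smoothing_lip hr (hc 0) H, fun x =>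
      (smoothing_hasFDerivAt hr (hc 0) H x).2.differentiableAt, fun v => ?_⟩
    change PLip p (c (0 + 1) * pNorm p v) _
    rw [hcn]
    exact smoothing_fderiv_lip hd hr (hc 0) H v
  | succ n ih =>
    intro c h hc hcn H
    refine ⟨smoothing_lip hr (hc 0) H.1, fun x =>
      (smoothing_hasFDerivAt hr (hc 0) H.1 x).2.differentiableAt, fun v => ?_⟩
    have e : (fun x => fderiv ℝ (_root_.smoothing p r h) x v) =
        _root_.smoothing p r (fun x => fderiv ℝ h x v) := by
      ext x
      obtain ⟨h1, h2⟩ := smoothing_hasFDerivAt hr (hc 0) H.1 x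
      rw [h2.fderiv, smoothing_eq, ContinuousLinearMap.integral_apply h1]
    rw [e]
    refine ih _ _ (fun i => mul_nonneg (hc _) (pNorm_nonneg _)) ?_ (H.2.2 v)
    rw [hcn]; ring

theorem Good.contDiff (n : ℕ) :
    ∀ (c : ℕ → ℝ) (h : (Fin d → ℝ) → ℝ), (∀ i, 0 ≤ c i) → Good p n c h → ContDiff ℝ n h := by
  induction n with
  | zero =>
    intro c h hc H
    obtain ⟨C, hC⟩ := PLip.lip (hc 0) H
    simpa using (contDiff_zero (𝕜 := ℝ)).2 hC.continuous
  | succ n ih =>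
    intro c h hc H
    push_cast
    rw [contDiff_succ_iff_fderiv_apply]
    exact ⟨H.2.1, by simp, fun v => ih _ _ (fun i => mul_nonneg (hc _) (pNorm_nonneg _)) (H.2.2 v)⟩

theorem Good.bound (i : ℕ) :
    ∀ (n : ℕ) (c : ℕ → ℝ) (h : (Fin d → ℝ) → ℝ), i ≤ n → (∀ i, 0 ≤ c i) → Good p n c h →
      ∀ v : Fin i → Fin d → ℝ, PLip p (c i * ∏ j, pNorm p (v j))
        (fun x => iteratedFDeriv ℝ i h x v) := by
  induction i with
  | zero =>
    intro n c h hi hc H v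
    simpa using H.zero
  | succ i ih =>
    intro n c h hi hc H v
    obtain ⟨n, rfl⟩ : ∃ m, n = m + 1 := ⟨n - 1, by omega⟩
    have hcd := Good.contDiff _ c h hc H
    have hcd' : ContDiff ℝ n (fderiv ℝ h) := by
      push_cast at hcd
      exact (contDiff_succ_iff_fderiv.1 hcd).2.2
    have e : ∀ x, iteratedFDeriv ℝ (i + 1) h x v =
        iteratedFDeriv ℝ i (fun y => fderiv ℝ h y (v (Fin.last i))) x (Fin.init v) := by
      intro x
      rw [iteratedFDeriv_succ_apply_right]
      have := ContinuousLinearMap.iteratedFDeriv_comp_left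
        (ContinuousLinearMap.apply ℝ ℝ (v (Fin.last i))) (hcd'.contDiffAt (x := x)) (i := i)
        (by exact_mod_cast (by omega : i ≤ n))
      have e2 : (fun y => fderiv ℝ h y (v (Fin.last i))) =
        (ContinuousLinearMap.apply ℝ ℝ (v (Fin.last i))) ∘ (fderiv ℝ h) := rfl
      rw [e2, this]
      rfl
    have := ih n _ _ (by omega) (fun i => mul_nonneg (hc _) (pNorm_nonneg _))
      (H.2.2 (v (Fin.last i))) (Fin.init v)
    simp only [e]
    rw [Fin.prod_univ_castSucc, mul_comm (∏ j : Fin i, _), ← mul_assoc]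
    exact this

end

/-- If `f` is `G`-Lipschitz w.r.t. `‖·‖_p`, then `S^{(q)}_β[f]` is `q`-times differentiable
and for `i ≤ q` and unit directions `v₁,…,v_i`, the map `x ↦ ∇^i S^{(q)}_β[f](x)[v₁,…,v_i]`
is `(d^i·2^{i(i+1)/2}·G/β^i)`-Lipschitz w.r.t. `‖·‖_p`. -/
theorem stmt12 {d : ℕ} (hd : 1 ≤ d) (p : ℝ≥0∞) (hp : 1 ≤ p)
    (q : ℕ) (hq : 1 ≤ q) (G β : ℝ) (hG : 0 < G) (hβ : 0 < β)
    (f : (Fin d → ℝ) → ℝ)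
    (hf : ∀ x y, |f x - f y| ≤ G * pNorm p (x - y)) :
    ContDiff ℝ (q : ℕ∞) (iterSmooth p β q f) ∧
    ∀ i : ℕ, i ≤ q → ∀ v : Fin i → Fin d → ℝ, (∀ j, pNorm p (v j) ≤ 1) →
      ∀ x y,
        |iteratedFDeriv ℝ i (iterSmooth p β q f) x v -
            iteratedFDeriv ℝ i (iterSmooth p β q f) y v| ≤
          ((d : ℝ) ^ i * 2 ^ (i * (i + 1) / 2) * G / β ^ i) * pNorm p (x - y) := by

  have : Fact (1 ≤ p) := ⟨hp⟩
  set a : ℕ → ℝ := fun i => (d : ℝ) ^ i * 2 ^ (i * (i + 1) / 2) * G / β ^ i with ha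
  have ha0 : ∀ i, 0 ≤ a i := fun i => by positivity
  have hstep : ∀ n, a (n + 1) = d / (β / 2 ^ (n + 1)) * a n := by
    intro n
    have : (n + 1) * (n + 1 + 1) / 2 = n * (n + 1) / 2 + (n + 1) := by
      have : (n + 1) * (n + 1 + 1) = n * (n + 1) + (n + 1) * 2 := by ring
      rw [this, Nat.add_mul_div_right _ _ (by norm_num)]
    simp only [ha, this]
    field_simp
    ring
  have hgood : ∀ n, Good p n a (iterSmooth p β n f) := by
    intro n
    induction n with
    | zero =>
      intro x y
      simpa [ha, iterSmooth] using hf x y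
    | succ n ih => exact Good.smoothing hd (by positivity) n a _ ha0 (hstep n) ih
  refine ⟨Good.contDiff q a _ ha0 (hgood q), fun i hi v hv x y => ?_⟩
  refine (Good.bound i q a _ hi ha0 (hgood q) v x y).trans ?_
  refine mul_le_mul_of_nonneg_right ?_ (pNorm_nonneg _)
  refine mul_le_of_le_one_right (ha0 i) ?_
  exact Finset.prod_le_one (fun j _ => pNorm_nonneg _) (fun j _ => hv j)
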